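/- Genus-1 tensor evaluated on two Euler fields and a dual-basis pair: Σ_α G₁(E, E, γ^α, γ_α) = 24 · Δ⟨⟨E²⟩⟩₁, where Δ⟨⟨E²⟩⟩₁ denotes the derivative of the function ⟨⟨E∘E⟩⟩₁ along the vector field Δ. -/

import Mathlib

open scoped BigOperators

/-- Points of the small phase space `ℂ^N`. -/
abbrev Pt (N : ℕ) := Fin N → ℂ

/-- Vector fields on `ℂ^N` (components with respect to the basis `γ_α`). -/
abbrev VF (N : ℕ) := Pt N → Pt N

/-- Partial derivative `∂/∂t^α`. -/
noncomputable def pd {N : ℕ} (α : Fin N) (F : Pt N → ℂ) : Pt N → ℂ :=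
  fun t => fderiv ℂ F t (Pi.single α 1)

/-- The `k`-point function `⟨⟨v₁ ⋯ v_k⟩⟩` associated with a generating function `F`. -/
noncomputable def corr {N : ℕ} : (Pt N → ℂ) → List (VF N) → Pt N → ℂ
  | F, [] => F
  | F, v :: vs => fun t => ∑ α, v t α * corr (pd α F) vs t

/-- Constant vector field associated with an element of `ℂ^N`. -/
def cvf {N : ℕ} (x : Pt N) : VF N := fun _ => x

/-- The basis vector field `γ_α`. -/
noncomputable def bas {N : ℕ} (α : Fin N) : VF N := cvf (Pi.single α 1)

/-- The dual basis vector field `γ^α = η^{αβ} γ_β`. -/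
noncomputable def dua {N : ℕ} (ηinv : Matrix (Fin N) (Fin N) ℂ) (α : Fin N) : VF N :=
  cvf (fun β => ηinv α β)

/-- The quantum product `v ∘ w := ⟨⟨v w γ^α⟩⟩₀ γ_α` of two vector fields. -/
noncomputable def qp {N : ℕ} (F : Pt N → ℂ) (ηinv : Matrix (Fin N) (Fin N) ℂ)
    (v w : VF N) : VF N :=
  fun t σ => corr F [v, w, dua ηinv σ] t

/-- The grading operator `G(Σ f_α γ_α) = Σ b_α f_α γ_α`. -/
def Gop {N : ℕ} (b : Fin N → ℂ) (v : VF N) : VF N := fun t α => b α * v t α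

/-- The Euler vector field `E = c + Σ_α (b₁ + 1 - b_α) t^α γ_α`. -/
def euler {N : ℕ} (c : Pt N) (b : Fin N → ℂ) (b1 : ℂ) : VF N :=
  fun t α => c α + (b1 + 1 - b α) * t α

/-- The quantum volume element `Δ := γ^α ∘ γ_α`. -/
noncomputable def qvol {N : ℕ} (F : Pt N → ℂ) (ηinv : Matrix (Fin N) (Fin N) ℂ) : VF N :=
  fun t => ∑ α, qp F ηinv (dua ηinv α) (bas α) t

/-- Covariant derivative `∇_v w` with respect to the trivial connection (`∇ γ_α = 0`). -/
noncomputable def nablaVF {N : ℕ} (v w : VF N) : VF N :=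
  fun t α => fderiv ℂ (fun s => w s α) t (v t)

/-- Derivative of a function along a vector field. -/
noncomputable def dirD {N : ℕ} (v : VF N) (f : Pt N → ℂ) : Pt N → ℂ :=
  fun t => fderiv ℂ f t (v t)

/-- Quantum powers of a vector field: `E⁰ := γ₁`, `E^{k+1} := E ∘ E^k`. -/
noncomputable def epow {N : ℕ} [NeZero N] (F : Pt N → ℂ) (ηinv : Matrix (Fin N) (Fin N) ℂ)
    (E : VF N) : ℕ → VF N
  | 0 => bas 0
  | k + 1 => qp F ηinv E (epow F ηinv E k)

/-- The genus-0 part `G₀` of Getzler's equation. -/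
noncomputable def G0func {N : ℕ} (F0 : Pt N → ℂ) (ηinv : Matrix (Fin N) (Fin N) ℂ)
    (v : Fin 4 → VF N) (t : Pt N) : ℂ :=
  ∑ g : Equiv.Perm (Fin 4),
    ((1/6) * ∑ α, corr F0 [v (g 0), v (g 1), v (g 2), dua ηinv α] t *
        (∑ β, corr F0 [bas α, v (g 3), bas β, dua ηinv β] t)
    + (1/24) * ∑ α, corr F0 [v (g 0), v (g 1), v (g 2), v (g 3), dua ηinv α] t *
        (∑ β, corr F0 [bas α, bas β, dua ηinv β] t)
    - (1/4) * ∑ α, ∑ β, corr F0 [v (g 0), v (g 1), dua ηinv α, dua ηinv β] t *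
        corr F0 [bas α, bas β, v (g 2), v (g 3)] t)

/-- The genus-1 part `G₁` of Getzler's equation. -/
noncomputable def G1func {N : ℕ} (F0 F1 : Pt N → ℂ) (ηinv : Matrix (Fin N) (Fin N) ℂ)
    (v : Fin 4 → VF N) (t : Pt N) : ℂ :=
  ∑ g : Equiv.Perm (Fin 4),
    (3 * corr F1 [qp F0 ηinv (v (g 0)) (v (g 1)), qp F0 ηinv (v (g 2)) (v (g 3))] t
    - 4 * corr F1 [qp F0 ηinv (qp F0 ηinv (v (g 0)) (v (g 1))) (v (g 2)), v (g 3)] t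
    - ∑ α, corr F0 [qp F0 ηinv (v (g 0)) (v (g 1)), v (g 2), v (g 3), dua ηinv α] t *
        corr F1 [bas α] t
    + 2 * ∑ α, corr F0 [v (g 0), v (g 1), v (g 2), dua ηinv α] t *
        corr F1 [qp F0 ηinv (bas α) (v (g 3))] t)

section Algebra

variable {V : Type*} [AddCommGroup V] [Module ℂ V] {ι : Type*} [Fintype ι]

open TensorProduct

theorem sum_perm_fin_four {M : Type*} [AddCommMonoid M] (f : Fin 4 → Fin 4 → Fin 4 → Fin 4 → M) :
    ∑ g : Equiv.Perm (Fin 4), f (g 0) (g 1) (g 2) (g 3) =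
      f 0 1 2 3 + f 0 1 3 2 + f 0 2 1 3 + f 0 2 3 1 + f 0 3 1 2 + f 0 3 2 1
      + f 1 0 2 3 + f 1 0 3 2 + f 1 2 0 3 + f 1 2 3 0 + f 1 3 0 2 + f 1 3 2 0
      + f 2 0 1 3 + f 2 0 3 1 + f 2 1 0 3 + f 2 1 3 0 + f 2 3 0 1 + f 2 3 1 0
      + f 3 0 1 2 + f 3 0 2 1 + f 3 1 0 2 + f 3 1 2 0 + f 3 2 0 1 + f 3 2 1 0 := by
  have h : (Finset.univ : Finset (Equiv.Perm (Fin 4))).val.map (fun g => (g 0, g 1, g 2, g 3)) =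
      {(0, 1, 2, 3), (0, 1, 3, 2), (0, 2, 1, 3), (0, 2, 3, 1), (0, 3, 1, 2), (0, 3, 2, 1),
       (1, 0, 2, 3), (1, 0, 3, 2), (1, 2, 0, 3), (1, 2, 3, 0), (1, 3, 0, 2), (1, 3, 2, 0),
       (2, 0, 1, 3), (2, 0, 3, 1), (2, 1, 0, 3), (2, 1, 3, 0), (2, 3, 0, 1), (2, 3, 1, 0),
       (3, 0, 1, 2), (3, 0, 2, 1), (3, 1, 0, 2), (3, 1, 2, 0), (3, 2, 0, 1), (3, 2, 1, 0)} := by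
    decide
  have h' := congrArg (fun s => (s.map fun p : Fin 4 × Fin 4 × Fin 4 × Fin 4 =>
    f p.1 p.2.1 p.2.2.1 p.2.2.2).sum) h
  simp only [Multiset.map_map, Function.comp_def] at h'
  rw [Finset.sum, h']
  simp [add_assoc]

/-- The tensor `G₁` at a point: `mul` is the quantum product, `Q` the fourth derivatives of `F₀`
with one index raised, `H` and `φ` the second and first derivatives of `F₁`. -/
def getzlerOne (mul : V →ₗ[ℂ] V →ₗ[ℂ] V) (Q : V →ₗ[ℂ] V →ₗ[ℂ] V →ₗ[ℂ] V)
    (H : V →ₗ[ℂ] V →ₗ[ℂ] ℂ) (φ : V →ₗ[ℂ] ℂ) (v : Fin 4 → V) : ℂ :=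
  ∑ g : Equiv.Perm (Fin 4),
    (3 * H (mul (v (g 0)) (v (g 1))) (mul (v (g 2)) (v (g 3)))
      - 4 * H (mul (mul (v (g 0)) (v (g 1))) (v (g 2))) (v (g 3))
      - φ (Q (mul (v (g 0)) (v (g 1))) (v (g 2)) (v (g 3)))
      + 2 * φ (mul (Q (v (g 0)) (v (g 1)) (v (g 2))) (v (g 3))))

variable {mul : V →ₗ[ℂ] V →ₗ[ℂ] V} {Q : V →ₗ[ℂ] V →ₗ[ℂ] V →ₗ[ℂ] V}
  {H : V →ₗ[ℂ] V →ₗ[ℂ] ℂ} {φ : V →ₗ[ℂ] ℂ} {G : V →ₗ[ℂ] V} {d e : ι → V}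

theorem getzlerOne_repeated
    (hcomm : ∀ x y, mul x y = mul y x)
    (hassoc : ∀ x y z, mul (mul x y) z = mul x (mul y z))
    (hQ₁ : ∀ x y z, Q x y z = Q y x z) (hQ₂ : ∀ x y z, Q x y z = Q x z y)
    (hH : ∀ x y, H x y = H y x) (u x y : V) :
    getzlerOne mul Q H φ ![u, u, x, y] =
      24 * H (mul u u) (mul x y) + 48 * H (mul u x) (mul u y) - 48 * H (mul u (mul x y)) u
      - 24 * H (mul u (mul u x)) y - 24 * H (mul u (mul u y)) x
      - 4 * φ (Q (mul u u) x y) - 4 * φ (Q u u (mul x y))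
      - 8 * φ (Q u (mul u x) y) - 8 * φ (Q u (mul u y) x)
      + 24 * φ (mul u (Q u x y)) + 12 * φ (mul (Q u u x) y) + 12 * φ (mul (Q u u y) x) := by
  rw [getzlerOne, sum_perm_fin_four (fun i j k l =>
    3 * H (mul (![u, u, x, y] i) (![u, u, x, y] j)) (mul (![u, u, x, y] k) (![u, u, x, y] l))
      - 4 * H (mul (mul (![u, u, x, y] i) (![u, u, x, y] j)) (![u, u, x, y] k)) (![u, u, x, y] l)
      - φ (Q (mul (![u, u, x, y] i) (![u, u, x, y] j)) (![u, u, x, y] k) (![u, u, x, y] l))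
      + 2 * φ (mul (Q (![u, u, x, y] i) (![u, u, x, y] j) (![u, u, x, y] k)) (![u, u, x, y] l)))]
  have hl : ∀ x y z, mul x (mul y z) = mul y (mul x z) := fun x y z => by
    rw [← hassoc, hcomm x y, hassoc]
  have e0 : (![u, u, x, y] : Fin 4 → V) 0 = u := rfl
  have e1 : (![u, u, x, y] : Fin 4 → V) 1 = u := rfl
  have e2 : (![u, u, x, y] : Fin 4 → V) 2 = x := rfl
  have e3 : (![u, u, x, y] : Fin 4 → V) 3 = y := rfl
  simp only [e0, e1, e2, e3, hassoc]
  rw [hcomm x u, hcomm y u, hcomm y x, hl x u y, hl y u x, hl x u u, hl y u u, hcomm x u,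
    hcomm y u, hcomm y x, hH (mul x y), hH (mul u y) (mul u x),
    hcomm (Q u x y) u, hcomm (Q x u y) u, hcomm (Q u y x) u, hcomm (Q x y u) u,
    hcomm (Q y u x) u, hcomm (Q y x u) u, hQ₁ x u u, hQ₁ y u u, hQ₂ u x u, hQ₂ u y u,
    hQ₁ x u y, hQ₁ y u x, hQ₂ u y x, hQ₂ x y u, hQ₂ y x u, hQ₁ x u y, hQ₁ y u x, hQ₂ u y x,
    hQ₁ (mul x y) u u, hQ₂ u (mul x y) u, hQ₂ (mul u x) y u, hQ₂ (mul u y) x u,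
    hQ₁ (mul u x) u y, hQ₁ (mul u y) u x, hQ₂ (mul u u) y x]
  ring

theorem sum_bilin_eq_of_tensor_eq {M : Type*} [AddCommGroup M] [Module ℂ M]
    {x y x' y' : ι → V} (h : ∑ i, x i ⊗ₜ[ℂ] y i = ∑ i, x' i ⊗ₜ[ℂ] y' i)
    (B : V →ₗ[ℂ] V →ₗ[ℂ] M) : ∑ i, B (x i) (y i) = ∑ i, B (x' i) (y' i) := by
  simpa using congrArg (TensorProduct.lift B) h

theorem sum_getzlerOne_euler
    (hcomm : ∀ x y, mul x y = mul y x)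
    (hassoc : ∀ x y z, mul (mul x y) z = mul x (mul y z))
    (hQ₁ : ∀ x y z, Q x y z = Q y x z) (hQ₂ : ∀ x y z, Q x y z = Q x z y)
    (hH : ∀ x y, H x y = H y x)
    (hQmul : ∀ a u v w, Q a (mul u v) w + mul (Q a u v) w = Q a u (mul v w) + mul u (Q a v w))
    (hswap : ∑ i, e i ⊗ₜ[ℂ] d i = ∑ i, d i ⊗ₜ[ℂ] e i)
    (hmul : ∀ u, ∑ i, mul u (d i) ⊗ₜ[ℂ] e i = ∑ i, d i ⊗ₜ[ℂ] mul u (e i))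
    (hG : ∑ i, G (d i) ⊗ₜ[ℂ] e i = ∑ i, d i ⊗ₜ[ℂ] (e i - G (e i)))
    {E : V} {k : ℂ}
    (hQE : ∀ x y, Q E x y = mul (G x) y + mul x (G y) - G (mul x y) - k • mul x y)
    (hHE : ∀ x, H x E = φ (G x) - (k + 1) * φ x)
    {Δ : V} (hΔ : ∑ i, mul (d i) (e i) = Δ) :
    ∑ i, getzlerOne mul Q H φ ![E, E, d i, e i] =
      24 * (H Δ (mul E E)
        + φ (Q Δ E E + (2 : ℂ) • mul E ((k + 1) • Δ - G Δ))) := by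
  have hl : ∀ x y z, mul x (mul y z) = mul y (mul x z) := fun x y z => by
    rw [← hassoc, hcomm x y, hassoc]
  -- symmetry of the sums over the dual pair
  have s₁ : ∑ i, H (mul E (mul E (e i))) (d i) = ∑ i, H (mul E (mul E (d i))) (e i) :=
    sum_bilin_eq_of_tensor_eq hswap (H.compl₁₂ (mul E ∘ₗ mul E) LinearMap.id)
  have s₂ : ∑ i, H (mul E (mul E (d i))) (e i) = ∑ i, H (mul E (d i)) (mul E (e i)) :=
    sum_bilin_eq_of_tensor_eq (hmul E) (H.compl₁₂ (mul E) LinearMap.id)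
  have s₃ : ∑ i, Q E (mul E (e i)) (d i) = ∑ i, Q E (mul E (d i)) (e i) :=
    sum_bilin_eq_of_tensor_eq hswap ((Q E).compl₁₂ (mul E) LinearMap.id)
  have s₄ : ∑ i, mul (Q E E (e i)) (d i) = ∑ i, mul (Q E E (d i)) (e i) :=
    sum_bilin_eq_of_tensor_eq hswap (mul.compl₁₂ (Q E E) LinearMap.id)
  have s₅ : ∑ i, mul (d i) (G (e i)) = ∑ i, mul (G (d i)) (e i) := by
    have h := sum_bilin_eq_of_tensor_eq hswap (mul.compl₁₂ G LinearMap.id)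
    simp only [LinearMap.compl₁₂_apply, LinearMap.id_apply] at h
    rw [← h]
    exact Finset.sum_congr rfl fun i _ => hcomm _ _
  have g₁ : ∑ i, mul (G (d i)) (e i) = (1 / 2 : ℂ) • Δ := by
    have h := sum_bilin_eq_of_tensor_eq hG mul
    simp only [map_sub, Finset.sum_sub_distrib, hΔ, s₅] at h
    have h2 : (2 : ℂ) • ∑ i, mul (G (d i)) (e i) = Δ := by
      rw [two_smul]; nth_rewrite 1 [h]; abel
    rw [← h2, smul_smul]; norm_num
  have g₁' : ∑ i, mul (d i) (G (e i)) = (1 / 2 : ℂ) • Δ := s₅.trans g₁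
  have g₂ : ∑ i, mul (G (mul E (d i))) (e i) = (1 / 2 : ℂ) • mul E Δ := by
    have h := sum_bilin_eq_of_tensor_eq (hmul E) (mul.compl₁₂ G LinearMap.id)
    simpa only [LinearMap.compl₁₂_apply, LinearMap.id_apply, hl _ E, ← map_sum, g₁,
      map_smul] using h
  -- the sums of `Q` over the dual pair
  have q₁ : ∑ i, mul (Q E E (d i)) (e i) = mul (G E) Δ - k • mul E Δ := by
    simp only [hQE, map_sub, map_add, map_smul, LinearMap.sub_apply, LinearMap.add_apply,
      LinearMap.smul_apply, hassoc, Finset.sum_sub_distrib, Finset.sum_add_distrib,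
      ← Finset.smul_sum, ← map_sum, hΔ, g₁, g₂]
    abel
  have q₂ : ∑ i, Q E (mul E (d i)) (e i) = mul E Δ - G (mul E Δ) - k • mul E Δ := by
    simp only [hQE, hassoc, Finset.sum_sub_distrib, Finset.sum_add_distrib,
      ← Finset.smul_sum, ← map_sum, hΔ, g₁', g₂, map_smul]
    module
  have q₃ : ∑ i, Q E (d i) (e i) = Δ - G Δ - k • Δ := by
    simp only [hQE, Finset.sum_sub_distrib, Finset.sum_add_distrib,
      ← Finset.smul_sum, ← map_sum, hΔ, g₁', g₁]
    module
  have q₄ : ∑ i, Q (mul E E) (d i) (e i) =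
      ∑ i, Q E (mul E (d i)) (e i) + mul E (∑ i, Q E (d i) (e i))
        - ∑ i, mul (Q E E (d i)) (e i) := by
    rw [eq_sub_iff_add_eq, ← s₃, map_sum, ← Finset.sum_add_distrib, ← Finset.sum_add_distrib]
    refine Finset.sum_congr rfl fun i _ => ?_
    have h := hQmul (d i) E E (e i)
    rwa [hQ₁ (d i), hQ₁ (d i), hQ₂ E (d i), hQ₁ (d i), hQ₂ E (d i), hQ₁ (d i)] at h
  simp only [getzlerOne_repeated hcomm hassoc hQ₁ hQ₂ hH, Finset.sum_sub_distrib,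
    Finset.sum_add_distrib, ← Finset.mul_sum, ← map_sum, s₁, s₂, s₃, s₄, hΔ, q₄, q₃, q₂, q₁,
    hHE]
  rw [hQ₁ Δ, hQ₂ E Δ, hQE E Δ, ← s₂, hH Δ]
  simp only [map_add, map_sub, map_smul, smul_eq_mul]
  ring

end Algebra

section Pointwise

variable {N : ℕ}

open TensorProduct

/-- The quantum product at a point. -/
noncomputable def qpAt (F : Pt N → ℂ) (ηinv : Matrix (Fin N) (Fin N) ℂ) (t : Pt N) :
    Pt N →ₗ[ℂ] Pt N →ₗ[ℂ] Pt N :=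
  ∑ α, (LinearMap.proj α).smulRight (∑ β, (LinearMap.proj β).smulRight
    (fun σ => ∑ γ, ηinv σ γ * pd γ (pd β (pd α F)) t))

/-- The vector `⟨⟨x y z γ^α⟩⟩₀ γ_α` at a point. -/
noncomputable def fourAt (F : Pt N → ℂ) (ηinv : Matrix (Fin N) (Fin N) ℂ) (t : Pt N) :
    Pt N →ₗ[ℂ] Pt N →ₗ[ℂ] Pt N →ₗ[ℂ] Pt N :=
  ∑ μ, (LinearMap.proj μ).smulRight (qpAt (pd μ F) ηinv t)

/-- The one-point function at a point. -/
noncomputable def oneAt (F : Pt N → ℂ) (t : Pt N) : Pt N →ₗ[ℂ] ℂ :=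
  ∑ α, (LinearMap.proj α).smulRight (pd α F t)

/-- The two-point function at a point. -/
noncomputable def twoAt (F : Pt N → ℂ) (t : Pt N) : Pt N →ₗ[ℂ] Pt N →ₗ[ℂ] ℂ :=
  ∑ α, (LinearMap.proj α).smulRight (oneAt (pd α F) t)

/-- The grading operator as a linear map. -/
def gradLin (b : Fin N → ℂ) : Pt N →ₗ[ℂ] Pt N :=
  LinearMap.pi fun α => b α • LinearMap.proj α

variable (F : Pt N → ℂ) (ηinv : Matrix (Fin N) (Fin N) ℂ) (t : Pt N)

theorem oneAt_apply (x : Pt N) : oneAt F t x = ∑ α, x α * pd α F t := by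
  simp [oneAt]

theorem twoAt_apply (x y : Pt N) :
    twoAt F t x y = ∑ α, x α * ∑ β, y β * pd β (pd α F) t := by
  simp [twoAt, oneAt_apply]

theorem qpAt_apply (x y : Pt N) (σ : Fin N) : qpAt F ηinv t x y σ =
    ∑ α, x α * ∑ β, y β * ∑ γ, ηinv σ γ * pd γ (pd β (pd α F)) t := by
  simp [qpAt]

theorem fourAt_apply (x y z : Pt N) :
    fourAt F ηinv t x y z = ∑ μ, x μ • qpAt (pd μ F) ηinv t y z := by
  simp [fourAt]

theorem gradLin_apply (b : Fin N → ℂ) (x : Pt N) (α : Fin N) :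
    gradLin b x α = b α * x α := rfl

theorem corr_one (v : VF N) : corr F [v] t = oneAt F t (v t) := by
  simp [corr, oneAt_apply]

theorem corr_two (v w : VF N) : corr F [v, w] t = twoAt F t (v t) (w t) := by
  simp [corr, twoAt_apply]

theorem qp_apply (v w : VF N) : qp F ηinv v w t = qpAt F ηinv t (v t) (w t) := by
  ext σ
  simp [qp, corr, qpAt_apply, dua, cvf]

theorem corr_four_dua (u v w : VF N) (σ : Fin N) :
    corr F [u, v, w, dua ηinv σ] t = fourAt F ηinv t (u t) (v t) (w t) σ := by
  simp [corr, fourAt_apply, qpAt_apply, dua, cvf]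

theorem corr_bas (α : Fin N) : corr F [bas α] t = pd α F t := by
  simp [corr, bas, cvf, Pi.single_apply]

theorem sum_smul_single (x : Pt N) : ∑ α, x α • (Pi.single α (1 : ℂ) : Pt N) = x := by
  ext β
  simp [Finset.sum_apply, Pi.single_apply]

theorem G1func_eq_getzlerOne (F0 F1 : Pt N → ℂ) (v : Fin 4 → VF N) :
    G1func F0 F1 ηinv v t = getzlerOne (qpAt F0 ηinv t) (fourAt F0 ηinv t) (twoAt F1 t)
      (oneAt F1 t) (fun i => v i t) := by
  rw [G1func, getzlerOne]
  refine Finset.sum_congr rfl fun g _ => ?_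
  congr 1
  · congr 1
    · simp only [corr_two, qp_apply]
    · simp only [corr_four_dua, corr_bas, qp_apply, oneAt_apply]
  · congr 1
    simp only [corr_four_dua, corr_one, qp_apply]
    conv_rhs => rw [← sum_smul_single (fourAt F0 ηinv t (v (g 0) t) (v (g 1) t) (v (g 2) t))]
    simp [bas, cvf]

theorem sum_tmul_eq_of_coord {ι : Type*} [Fintype ι] {x y x' y' : ι → Pt N}
    (h : ∀ σ τ, ∑ i, x i σ * y i τ = ∑ i, x' i σ * y' i τ) :
    ∑ i, x i ⊗ₜ[ℂ] y i = ∑ i, x' i ⊗ₜ[ℂ] y' i := by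
  have key : ∀ x y : ι → Pt N, ∑ i, x i ⊗ₜ[ℂ] y i =
      ∑ σ, ∑ τ, (∑ i, x i σ * y i τ) •
        ((Pi.single σ (1 : ℂ) : Pt N) ⊗ₜ[ℂ] (Pi.single τ (1 : ℂ) : Pt N)) := by
    intro x y
    simp only [Finset.sum_smul]
    simp only [Finset.sum_comm (s := (Finset.univ : Finset (Fin N))) (t := (Finset.univ : Finset ι))]
    refine Finset.sum_congr rfl fun i _ => ?_
    conv_lhs => rw [← sum_smul_single (x i), ← sum_smul_single (y i)]
    simp only [TensorProduct.sum_tmul, TensorProduct.tmul_sum, TensorProduct.smul_tmul_smul]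
    exact Finset.sum_comm
  rw [key, key]
  simp only [h]

end Pointwise

section Derivatives

variable {N : ℕ}

/-- Entire analytic functions on the small phase space. -/
def IsEntire (F : Pt N → ℂ) : Prop := ∀ t, AnalyticAt ℂ F t

theorem IsEntire.differentiable {F : Pt N → ℂ} (hF : IsEntire F) : Differentiable ℂ F :=
  fun t => (hF t).differentiableAt

theorem IsEntire.pd {F : Pt N → ℂ} (hF : IsEntire F) (α : Fin N) : IsEntire (pd α F) := by
  intro t
  exact ((ContinuousLinearMap.apply ℂ ℂ (Pi.single α (1 : ℂ) : Pt N)).analyticAt _).comp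
    (hF t).fderiv

theorem pd_comm {F : Pt N → ℂ} (hF : IsEntire F) (α β : Fin N) :
    pd α (pd β F) = pd β (pd α F) := by
  funext t
  have hs : IsSymmSndFDerivAt ℂ F t :=
    (hF t).contDiffAt.isSymmSndFDerivAt (n := ⊤) (by simp)
  have hd : DifferentiableAt ℂ (fderiv ℂ F) t := (hF t).fderiv.differentiableAt
  have key : ∀ α β : Fin N, _root_.pd α (_root_.pd β F) t =
      fderiv ℂ (fderiv ℂ F) t (Pi.single α 1) (Pi.single β 1) := by
    intro α β
    unfold _root_.pd
    rw [fderiv_clm_apply hd (by fun_prop)]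
    simp
  rw [key, key, hs.eq]

theorem fderiv_eq_oneAt {F : Pt N → ℂ} (t a : Pt N) : fderiv ℂ F t a = oneAt F t a := by
  rw [oneAt_apply]
  conv_lhs => rw [← sum_smul_single a]
  simp [_root_.pd]

theorem hasLineDerivAt_oneAt {F : Pt N → ℂ} (hF : IsEntire F) (t a : Pt N) :
    HasLineDerivAt ℂ F (oneAt F t a) t a := by
  rw [← fderiv_eq_oneAt]
  exact (hF.differentiable t).hasFDerivAt.hasLineDerivAt a

/-- The three-point function at a point. -/
noncomputable def threeAt (F : Pt N → ℂ) (t : Pt N) :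
    Pt N →ₗ[ℂ] Pt N →ₗ[ℂ] Pt N →ₗ[ℂ] ℂ :=
  ∑ α, (LinearMap.proj α).smulRight (twoAt (pd α F) t)

theorem threeAt_apply (F : Pt N → ℂ) (t x y z : Pt N) :
    threeAt F t x y z = ∑ α, x α * twoAt (pd α F) t y z := by
  simp [threeAt]

theorem twoAt_eq_sum_oneAt (F : Pt N → ℂ) (t x y : Pt N) :
    twoAt F t x y = ∑ α, x α * oneAt (pd α F) t y := by
  simp [twoAt]

theorem twoAt_comm {F : Pt N → ℂ} (hF : IsEntire F) (t x y : Pt N) :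
    twoAt F t x y = twoAt F t y x := by
  simp only [twoAt_apply, Finset.mul_sum]
  rw [Finset.sum_comm]
  simp only [mul_left_comm (x _) (y _), pd_comm hF]

theorem threeAt_comm_right {F : Pt N → ℂ} (hF : IsEntire F) (t x y z : Pt N) :
    threeAt F t x y z = threeAt F t x z y := by
  simp only [threeAt_apply, twoAt_comm (hF.pd _) t y z]

theorem threeAt_comm_left {F : Pt N → ℂ} (hF : IsEntire F) (t x y z : Pt N) :
    threeAt F t x y z = threeAt F t y x z := by
  simp only [threeAt_apply, twoAt_eq_sum_oneAt, Finset.mul_sum]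
  rw [Finset.sum_comm]
  simp only [mul_left_comm (x _) (y _), pd_comm hF]

theorem qpAt_eq_threeAt {F : Pt N → ℂ} (hF : IsEntire F) (ηinv : Matrix (Fin N) (Fin N) ℂ)
    (t x y : Pt N) (σ : Fin N) : qpAt F ηinv t x y σ = threeAt F t (ηinv σ) x y := by
  rw [threeAt_comm_left hF, threeAt_comm_right hF]
  simp only [threeAt_apply, qpAt_apply, twoAt_apply]

theorem qpAt_comm {F : Pt N → ℂ} (hF : IsEntire F) (ηinv : Matrix (Fin N) (Fin N) ℂ)
    (t x y : Pt N) : qpAt F ηinv t x y = qpAt F ηinv t y x := by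
  ext σ
  rw [qpAt_eq_threeAt hF, qpAt_eq_threeAt hF, threeAt_comm_right hF]

theorem fourAt_comm_right {F : Pt N → ℂ} (hF : IsEntire F) (ηinv : Matrix (Fin N) (Fin N) ℂ)
    (t x y z : Pt N) : fourAt F ηinv t x y z = fourAt F ηinv t x z y := by
  simp only [fourAt_apply, qpAt_comm (hF.pd _) ηinv t y z]

theorem fourAt_comm_left {F : Pt N → ℂ} (hF : IsEntire F) (ηinv : Matrix (Fin N) (Fin N) ℂ)
    (t x y z : Pt N) : fourAt F ηinv t x y z = fourAt F ηinv t y x z := by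
  ext σ
  simp only [fourAt_apply, Finset.sum_apply, Pi.smul_apply, smul_eq_mul, qpAt_apply,
    Finset.mul_sum]
  rw [Finset.sum_comm]
  simp only [mul_left_comm (x _) (y _), pd_comm hF]

theorem hasDerivAt_oneAt {F : Pt N → ℂ} (hF : IsEntire F) (t a : Pt N) {x : ℂ → Pt N}
    {x' : Pt N} (hx : HasDerivAt x x' 0) :
    HasDerivAt (fun s => oneAt F (t + s • a) (x s))
      (twoAt F t a (x 0) + oneAt F t x') 0 := by
  simp only [oneAt_apply]
  refine (HasDerivAt.fun_sum fun α (_ : α ∈ Finset.univ) =>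
    (hasDerivAt_pi.1 hx α).fun_mul (hasLineDerivAt_oneAt (hF.pd α) t a)).congr_deriv ?_
  rw [Finset.sum_add_distrib, twoAt_comm hF, twoAt_eq_sum_oneAt, add_comm]
  simp

theorem hasDerivAt_twoAt {F : Pt N → ℂ} (hF : IsEntire F) (t a : Pt N) {x y : ℂ → Pt N}
    {x' y' : Pt N} (hx : HasDerivAt x x' 0) (hy : HasDerivAt y y' 0) :
    HasDerivAt (fun s => twoAt F (t + s • a) (x s) (y s))
      (threeAt F t a (x 0) (y 0) + twoAt F t x' (y 0) + twoAt F t (x 0) y') 0 := by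
  simp only [twoAt_eq_sum_oneAt]
  refine (HasDerivAt.fun_sum fun α (_ : α ∈ Finset.univ) =>
    (hasDerivAt_pi.1 hx α).fun_mul (hasDerivAt_oneAt (hF.pd α) t a hy)).congr_deriv ?_
  simp only [mul_add, Finset.sum_add_distrib, threeAt_comm_left hF _ a, threeAt_apply]
  simp only [zero_smul, add_zero]
  ring

theorem hasDerivAt_qpAt {F : Pt N → ℂ} (hF : IsEntire F) (ηinv : Matrix (Fin N) (Fin N) ℂ)
    (t a : Pt N) {x y : ℂ → Pt N} {x' y' : Pt N} (hx : HasDerivAt x x' 0)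
    (hy : HasDerivAt y y' 0) :
    HasDerivAt (fun s => qpAt F ηinv (t + s • a) (x s) (y s))
      (fourAt F ηinv t a (x 0) (y 0) + qpAt F ηinv t x' (y 0) + qpAt F ηinv t (x 0) y') 0 := by
  refine hasDerivAt_pi.2 fun σ => ?_
  simp only [Pi.add_apply, qpAt_eq_threeAt hF, threeAt_apply]
  refine (HasDerivAt.fun_sum fun γ (_ : γ ∈ Finset.univ) =>
    (hasDerivAt_twoAt (hF.pd γ) t a hx hy).const_mul (ηinv σ γ)).congr_deriv ?_
  simp only [mul_add, Finset.sum_add_distrib, fourAt_apply, Finset.sum_apply, Pi.smul_apply,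
    qpAt_eq_threeAt (hF.pd _), threeAt_apply, smul_eq_mul, Finset.mul_sum]
  congr 2
  rw [Finset.sum_comm]
  simp only [mul_left_comm (a _), pd_comm hF]

theorem hasDerivAt_line_coord (t a : Pt N) (μ : Fin N) :
    HasDerivAt (fun s : ℂ => (t + s • a) μ) (a μ) 0 := by
  simpa using ((hasDerivAt_id (0 : ℂ)).mul_const (a μ)).const_add (t μ)

theorem hasDerivAt_euler (c : Pt N) (b : Fin N → ℂ) (κ : ℂ) (t a : Pt N) :
    HasDerivAt (fun s : ℂ => euler c b κ (t + s • a)) ((κ + 1) • a - gradLin b a) 0 := by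
  refine hasDerivAt_pi.2 fun μ => ?_
  refine (((hasDerivAt_line_coord t a μ).const_mul (κ + 1 - b μ)).const_add (c μ)).congr_deriv ?_
  simp [gradLin_apply]
  ring

/-- Differentiating a homogeneity relation along the Euler field. -/
theorem oneAt_pd_euler {F g : Pt N → ℂ} (hF : IsEntire F) {c : Pt N} {b : Fin N → ℂ} {κ : ℂ}
    (hg : ∀ t, oneAt F t (euler c b κ t) = g t) {t : Pt N} {α : Fin N} {g' : ℂ}
    (hg' : HasLineDerivAt ℂ g g' t (Pi.single α 1)) :
    oneAt (pd α F) t (euler c b κ t) = g' - (κ + 1 - b α) * pd α F t := by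
  have h := hasDerivAt_oneAt hF t (Pi.single α 1) (hasDerivAt_euler c b κ t (Pi.single α 1))
  simp only [hg] at h
  have h' := h.unique hg'
  rw [← h']
  simp [twoAt_eq_sum_oneAt, oneAt_apply, gradLin_apply, Pi.single_apply, sub_mul]

theorem hasLineDerivAt_pd {F : Pt N → ℂ} (hF : IsEntire F) (t : Pt N) (α : Fin N) :
    HasLineDerivAt ℂ F (pd α F t) t (Pi.single α 1) :=
  (hF.differentiable t).hasFDerivAt.hasLineDerivAt _

theorem hasLineDerivAt_quadratic (C : Matrix (Fin N) (Fin N) ℂ) (t a : Pt N) :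
    HasLineDerivAt ℂ (fun t : Pt N => ∑ α, ∑ β, C α β * t α * t β)
      (∑ α, ∑ β, C α β * (a α * t β + t α * a β)) t a := by
  refine HasDerivAt.fun_sum fun α _ => HasDerivAt.fun_sum fun β _ => ?_
  refine (((hasDerivAt_line_coord t a α).const_mul (C α β)).fun_mul
    (hasDerivAt_line_coord t a β)).congr_deriv ?_
  simp
  ring

theorem hasLineDerivAt_polar (C : Matrix (Fin N) (Fin N) ℂ) (d t a : Pt N) :
    HasLineDerivAt ℂ (fun t : Pt N => ∑ α, ∑ β, C α β * (d α * t β + t α * d β))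
      (∑ α, ∑ β, C α β * (d α * a β + a α * d β)) t a := by
  refine HasDerivAt.fun_sum fun α _ => HasDerivAt.fun_sum fun β _ => ?_
  exact (((hasDerivAt_line_coord t a β).const_mul (d α)).fun_add
    ((hasDerivAt_line_coord t a α).mul_const (d β))).const_mul (C α β)

theorem oneAt_pd_pd_pd_euler {F : Pt N → ℂ} (hF : IsEntire F) {c : Pt N} {b : Fin N → ℂ} {κ : ℂ}
    {C : Matrix (Fin N) (Fin N) ℂ}
    (hg : ∀ t, oneAt F t (euler c b κ t)
      = 2 * (κ + 1) * F t + (1 / 2) * ∑ α, ∑ β, C α β * t α * t β) (t : Pt N) (α β γ : Fin N) :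
    oneAt (pd γ (pd β (pd α F))) t (euler c b κ t) =
      (b α + b β + b γ - (κ + 1)) * pd γ (pd β (pd α F)) t := by
  have h₁ := fun t => oneAt_pd_euler hF hg (t := t) (α := α)
    (((hasLineDerivAt_pd hF t α).const_mul (2 * (κ + 1))).fun_add
      ((hasLineDerivAt_quadratic C t _).const_mul (1 / 2)))
  have h₂ := fun t => oneAt_pd_euler (hF.pd α) h₁ (t := t) (α := β)
    ((((hasLineDerivAt_pd (hF.pd α) t β).const_mul (2 * (κ + 1))).fun_add
      ((hasLineDerivAt_polar C _ t _).const_mul (1 / 2))).fun_sub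
      ((hasLineDerivAt_pd (hF.pd α) t β).const_mul (κ + 1 - b α)))
  have h₃ := oneAt_pd_euler ((hF.pd α).pd β) h₂ (t := t) (α := γ)
    ((((hasLineDerivAt_pd ((hF.pd α).pd β) t γ).const_mul (2 * (κ + 1))).fun_add
      (hasDerivAt_const _ _)).fun_sub
      ((hasLineDerivAt_pd ((hF.pd α).pd β) t γ).const_mul (κ + 1 - b α))|>.fun_sub
      ((hasLineDerivAt_pd ((hF.pd α).pd β) t γ).const_mul (κ + 1 - b β)))
  rw [h₃]
  ring

theorem twoAt_euler {F : Pt N → ℂ} (hF : IsEntire F) {c : Pt N} {b : Fin N → ℂ} {κ k : ℂ}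
    (hk : ∀ t, oneAt F t (euler c b κ t) = k) (t x : Pt N) :
    twoAt F t x (euler c b κ t) = oneAt F t (gradLin b x) - (κ + 1) * oneAt F t x := by
  have h := fun α => oneAt_pd_euler hF hk (t := t) (α := α) (hasDerivAt_const _ _)
  simp only [twoAt_eq_sum_oneAt, h, oneAt_apply, gradLin_apply, Finset.mul_sum,
    ← Finset.sum_sub_distrib]
  exact Finset.sum_congr rfl fun α _ => by ring

theorem fourAt_euler {F : Pt N → ℂ} (hF : IsEntire F) {ηinv : Matrix (Fin N) (Fin N) ℂ}
    {c : Pt N} {b : Fin N → ℂ} {κ : ℂ} {C : Matrix (Fin N) (Fin N) ℂ}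
    (hb : ∀ α β, ηinv α β ≠ 0 → b α + b β = 1)
    (hg : ∀ t, oneAt F t (euler c b κ t)
      = 2 * (κ + 1) * F t + (1 / 2) * ∑ α, ∑ β, C α β * t α * t β) (t x y : Pt N) :
    fourAt F ηinv t (euler c b κ t) x y =
      qpAt F ηinv t (gradLin b x) y + qpAt F ηinv t x (gradLin b y)
        - gradLin b (qpAt F ηinv t x y) - κ • qpAt F ηinv t x y := by
  ext σ
  have hη : ∀ γ, ηinv σ γ * b γ = ηinv σ γ * (1 - b σ) := by
    intro γ
    by_cases h : ηinv σ γ = 0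
    · simp [h]
    · rw [← hb σ γ h]; ring
  rw [fourAt_comm_left hF, fourAt_comm_right hF]
  simp only [fourAt_apply, Finset.sum_apply, Pi.smul_apply, Pi.sub_apply, Pi.add_apply,
    smul_eq_mul, gradLin_apply, qpAt_apply (pd _ F)]
  simp only [qpAt_apply, gradLin_apply, Finset.mul_sum, ← Finset.sum_sub_distrib,
    ← Finset.sum_add_distrib]
  refine Finset.sum_congr rfl fun α _ => Finset.sum_congr rfl fun β _ => ?_
  rw [Finset.sum_comm]
  refine Finset.sum_congr rfl fun γ _ => ?_
  have h := oneAt_pd_pd_pd_euler hF hg t α β γ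
  rw [oneAt_apply] at h
  simp only [mul_left_comm (euler c b κ t _) (ηinv σ γ), ← Finset.mul_sum,
    pd_comm ((hF.pd α).pd β) γ]
  rw [h]
  linear_combination x α * y β * pd γ (pd β (pd α F)) t * hη γ

end Derivatives

section DualPair

variable {N : ℕ} {ηinv : Matrix (Fin N) (Fin N) ℂ}

open TensorProduct

theorem sum_basis_tmul_dual (hη : ηinv.IsSymm) :
    ∑ i, (Pi.single i (1 : ℂ) : Pt N) ⊗ₜ[ℂ] (ηinv i : Pt N) =
      ∑ i, (ηinv i : Pt N) ⊗ₜ[ℂ] (Pi.single i (1 : ℂ) : Pt N) := by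
  refine sum_tmul_eq_of_coord fun σ τ => ?_
  simp [Pi.single_apply, hη.apply σ τ]

theorem sum_grad_dual_tmul_basis {b : Fin N → ℂ} (hb : ∀ α β, ηinv α β ≠ 0 → b α + b β = 1) :
    ∑ i, gradLin b (ηinv i) ⊗ₜ[ℂ] (Pi.single i (1 : ℂ) : Pt N) =
      ∑ i, (ηinv i : Pt N) ⊗ₜ[ℂ] ((Pi.single i (1 : ℂ) : Pt N) - gradLin b (Pi.single i 1)) := by
  refine sum_tmul_eq_of_coord fun σ τ => ?_
  simp only [gradLin_apply, Pi.sub_apply, Pi.single_apply]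
  simp only [mul_ite, mul_one, mul_zero, mul_sub, Finset.sum_sub_distrib, Finset.sum_ite_eq,
    Finset.mem_univ, if_true]
  by_cases h : ηinv τ σ = 0
  · simp [h]
  · linear_combination ηinv τ σ * hb τ σ h

theorem sum_qpAt_dual_tmul_basis (hη : ηinv.IsSymm) {F : Pt N → ℂ} (hF : IsEntire F)
    (t u : Pt N) :
    ∑ i, qpAt F ηinv t u (ηinv i) ⊗ₜ[ℂ] (Pi.single i (1 : ℂ) : Pt N) =
      ∑ i, (ηinv i : Pt N) ⊗ₜ[ℂ] qpAt F ηinv t u (Pi.single i 1) := by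
  refine sum_tmul_eq_of_coord fun σ τ => ?_
  have h₁ : ∑ i, qpAt F ηinv t u (ηinv i) σ * (Pi.single i (1 : ℂ) : Pt N) τ =
      threeAt F t (ηinv σ) u (ηinv τ) := by
    simp [Pi.single_apply, qpAt_eq_threeAt hF]
  have h₂ : ∑ i, ηinv i σ * qpAt F ηinv t u (Pi.single i 1) τ =
      threeAt F t (ηinv τ) u (ηinv σ) := by
    conv_rhs => rw [← sum_smul_single (ηinv σ)]
    simp [qpAt_eq_threeAt hF, hη.apply σ]
  rw [h₁, h₂, threeAt_comm_right hF, threeAt_comm_left hF, threeAt_comm_right hF]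

theorem fourAt_qpAt {F : Pt N → ℂ} (hF : IsEntire F)
    (hassoc : ∀ t u v w, qpAt F ηinv t (qpAt F ηinv t u v) w =
      qpAt F ηinv t u (qpAt F ηinv t v w)) (t a u v w : Pt N) :
    fourAt F ηinv t a (qpAt F ηinv t u v) w + qpAt F ηinv t (fourAt F ηinv t a u v) w =
      fourAt F ηinv t a u (qpAt F ηinv t v w) + qpAt F ηinv t u (fourAt F ηinv t a v w) := by
  have hc : ∀ z : Pt N, HasDerivAt (fun _ : ℂ => z) 0 0 := fun z => hasDerivAt_const _ _
  have h₁ := hasDerivAt_qpAt hF ηinv t a (hasDerivAt_qpAt hF ηinv t a (hc u) (hc v)) (hc w)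
  have h₂ := hasDerivAt_qpAt hF ηinv t a (hc u) (hasDerivAt_qpAt hF ηinv t a (hc v) (hc w))
  simp only [hassoc] at h₁
  simpa using h₁.unique h₂

theorem differentiable_oneAt_qpAt_euler {F0 F1 : Pt N → ℂ} (hF0 : IsEntire F0)
    (hF1 : IsEntire F1) (c : Pt N) (b : Fin N → ℂ) (κ : ℂ) :
    Differentiable ℂ fun t =>
      oneAt F1 t (qpAt F0 ηinv t (euler c b κ t) (euler c b κ t)) := by
  have h₁ := fun α => (hF1.pd α).differentiable
  have h₀ := fun α β γ => (((hF0.pd α).pd β).pd γ).differentiable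
  simp only [oneAt_apply, qpAt_apply, euler]
  fun_prop

theorem dirD_corr_euler_sq {F0 F1 : Pt N → ℂ} (hF0 : IsEntire F0) (hF1 : IsEntire F1)
    (c : Pt N) (b : Fin N → ℂ) (κ : ℂ) (v : VF N) (t : Pt N) :
    dirD v (corr F1 [qp F0 ηinv (euler c b κ) (euler c b κ)]) t =
      twoAt F1 t (v t) (qpAt F0 ηinv t (euler c b κ t) (euler c b κ t))
      + oneAt F1 t (fourAt F0 ηinv t (v t) (euler c b κ t) (euler c b κ t)
        + (2 : ℂ) • qpAt F0 ηinv t (euler c b κ t) ((κ + 1) • v t - gradLin b (v t))) := by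
  have hcorr : corr F1 [qp F0 ηinv (euler c b κ) (euler c b κ)] = fun t =>
      oneAt F1 t (qpAt F0 ηinv t (euler c b κ t) (euler c b κ t)) := by
    funext t
    rw [corr_one, qp_apply]
  have hE := hasDerivAt_euler c b κ t (v t)
  have h := hasDerivAt_oneAt hF1 t (v t) (hasDerivAt_qpAt hF0 ηinv t (v t) hE hE)
  have hd := ((differentiable_oneAt_qpAt_euler (ηinv := ηinv) hF0 hF1 c b κ t).hasFDerivAt
    ).hasLineDerivAt (v t)
  rw [dirD, hcorr]
  refine (HasDerivAt.unique hd h).trans ?_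
  rw [qpAt_comm hF0 ηinv t _ (euler c b κ (t + (0 : ℂ) • v t)), two_smul, ← add_assoc]
  simp only [zero_smul, add_zero]

end DualPair

/-- Genus-1 tensor evaluated on two Euler fields and a dual-basis pair:
`Σ_α G₁(E, E, γ^α, γ_α) = 24 · Δ⟨⟨E²⟩⟩₁`. -/
theorem G1_euler_euler_dual_pair
    {N : ℕ} [NeZero N]
    (ηm ηinv : Matrix (Fin N) (Fin N) ℂ)
    (hηsym : ηm.IsSymm)
    (hη1 : ηm * ηinv = 1) (hη2 : ηinv * ηm = 1)
    (b : Fin N → ℂ)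
    (hb : ∀ α β, ηinv α β ≠ 0 → b α + b β = 1)
    (c : Pt N) (C : Matrix (Fin N) (Fin N) ℂ) (hC : C.IsSymm)
    (F0 F1 : Pt N → ℂ)
    (hF0 : ∀ t, AnalyticAt ℂ F0 t) (hF1 : ∀ t, AnalyticAt ℂ F1 t)
    (hid : ∀ v : VF N, qp F0 ηinv (bas 0) v = v)
    (hwdvv : ∀ u v w : VF N,
      qp F0 ηinv (qp F0 ηinv u v) w = qp F0 ηinv u (qp F0 ηinv v w))
    (hqh0 : ∀ t, fderiv ℂ F0 t (euler c b (b 0) t)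
      = 2 * (b 0 + 1) * F0 t + (1/2) * ∑ α, ∑ β, C α β * t α * t β)
    (hqh1 : ∃ k : ℂ, ∀ t, fderiv ℂ F1 t (euler c b (b 0) t) = k) :
    ∀ t : Pt N,
      ∑ α, G1func F0 F1 ηinv
          ![euler c b (b 0), euler c b (b 0), dua ηinv α, bas α] t
        = 24 * dirD (qvol F0 ηinv)
            (corr F1 [qp F0 ηinv (euler c b (b 0)) (euler c b (b 0))]) t := by
  have hηinv : ηinv.IsSymm := by
    have h : ηinv.transpose * ηm = 1 := by
      simpa [Matrix.transpose_mul, hηsym.eq] using congrArg Matrix.transpose hη1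
    exact left_inv_eq_right_inv h hη1
  have hassoc : ∀ t u v w, qpAt F0 ηinv t (qpAt F0 ηinv t u v) w =
      qpAt F0 ηinv t u (qpAt F0 ηinv t v w) := by
    intro t u v w
    simpa only [qp_apply, cvf] using congrFun (hwdvv (cvf u) (cvf v) (cvf w)) t
  obtain ⟨k, hk⟩ := hqh1
  intro t
  have hΔ : ∑ i, qpAt F0 ηinv t (ηinv i) (Pi.single i 1) = qvol F0 ηinv t := by
    simp only [qvol, qp_apply, dua, bas, cvf]
  have hv : ∀ α, (fun i => (![euler c b (b 0), euler c b (b 0), dua ηinv α, bas α] :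
      Fin 4 → VF N) i t) = ![euler c b (b 0) t, euler c b (b 0) t, ηinv α, Pi.single α 1] := by
    intro α
    funext i
    fin_cases i <;> rfl
  simp only [G1func_eq_getzlerOne, hv, dirD_corr_euler_sq (ηinv := ηinv) hF0 hF1]
  exact sum_getzlerOne_euler (qpAt_comm hF0 ηinv t) (hassoc t) (fourAt_comm_left hF0 ηinv t)
    (fourAt_comm_right hF0 ηinv t) (twoAt_comm hF1 t) (fourAt_qpAt hF0 hassoc t)
    (sum_basis_tmul_dual hηinv) (sum_qpAt_dual_tmul_basis hηinv hF0 t)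
    (sum_grad_dual_tmul_basis hb)
    (fourAt_euler hF0 hb (C := C) (by simpa only [fderiv_eq_oneAt] using hqh0) t)
    (twoAt_euler hF1 (by simpa only [fderiv_eq_oneAt] using hk) t) hΔ
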